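/- Let d ≥ 2 and let f, g ∈ ℂ[x,y] be polynomials of degree at most d whose coefficients — the (d+1)(d+2) complex numbers f_{ij}, g_{ij} for i+j ≤ d — are algebraically independent over ℚ. Then the planar vector field v = f ∂/∂x + g ∂/∂y admits no invariant algebraic curve: there is no nonconstant polynomial P ∈ ℂ[x,y] such that f·(∂P/∂x) + g·(∂P/∂y) lies in the ideal generated by P. -/

import Mathlib

section DerivationExistence
open MvPolynomial

theorem exists_deriv_of_basis {ι : Type} {x : ι → ℂ} (hx : IsTranscendenceBasis ℚ x) (w : ι → ℂ) :
    ∃ D : Derivation ℚ ℂ ℂ, ∀ i, D (x i) = w i := by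
  let alg : Algebra (MvPolynomial ι ℚ) ℂ :=
    (aeval x : MvPolynomial ι ℚ →ₐ[ℚ] ℂ).toRingHom.toAlgebra
  have hmap : ∀ p, algebraMap (MvPolynomial ι ℚ) ℂ p = aeval x p := fun p => rfl
  have : IsScalarTower ℚ (MvPolynomial ι ℚ) ℂ := IsScalarTower.of_algebraMap_eq (fun q => by
    rw [hmap]; simp)
  have : FaithfulSMul (MvPolynomial ι ℚ) ℂ := (faithfulSMul_iff_algebraMap_injective _ _).2 hx.1
  let K := FractionRing (MvPolynomial ι ℚ)
  let : Algebra K ℂ := FractionRing.liftAlgebra _ _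
  have : IsScalarTower (MvPolynomial ι ℚ) K ℂ := inferInstance
  have : Algebra.IsAlgebraic (MvPolynomial ι ℚ) ℂ := by
    have := hx.isAlgebraic
    refine Algebra.IsAlgebraic.of_ringHom_of_comp_eq (S := Algebra.adjoin ℚ (Set.range x)) (B := ℂ)
      hx.1.aevalEquiv (RingHom.id ℂ) hx.1.aevalEquiv.surjective Function.injective_id ?_
    ext y <;> simp [hmap]
  have : Algebra.IsAlgebraic K ℂ :=
    (IsFractionRing.comap_isAlgebraic_iff (A := MvPolynomial ι ℚ)).1 inferInstance
  have : CharZero K := inferInstance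
  have : Algebra.FormallyEtale (MvPolynomial ι ℚ) K :=
    Algebra.FormallyEtale.of_isLocalization (nonZeroDivisors _)
  have : Algebra.FormallyEtale K ℂ := Algebra.FormallyEtale.of_isSeparable K ℂ
  have : Algebra.FormallyEtale (MvPolynomial ι ℚ) ℂ := Algebra.FormallyEtale.comp _ K _
  let D0 : Derivation ℚ (MvPolynomial ι ℚ) ℂ := mkDerivation ℚ w
  let φ := (D0.liftKaehlerDifferential.liftBaseChange ℂ) ∘ₗ
    (KaehlerDifferential.tensorKaehlerEquivOfFormallyEtale ℚ (MvPolynomial ι ℚ) ℂ).symm.toLinearMap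
  refine ⟨φ.compDer (KaehlerDifferential.D ℚ ℂ), fun i => ?_⟩
  have h1 : x i = algebraMap (MvPolynomial ι ℚ) ℂ (X i) := by rw [hmap]; simp
  change φ (KaehlerDifferential.D ℚ ℂ (x i)) = w i
  simp only [φ, LinearMap.comp_apply, LinearEquiv.coe_coe]
  rw [h1, KaehlerDifferential.tensorKaehlerEquivOfFormallyEtale_symm_D_algebraMap]
  simp [D0, mkDerivation_X]

theorem exists_deriv {ι : Type} {x : ι → ℂ} (hx : AlgebraicIndependent ℚ x) (w : ι → ℂ) :
    ∃ D : Derivation ℚ ℂ ℂ, ∀ i, D (x i) = w i := by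
  obtain ⟨t, hxt, ht⟩ := exists_isTranscendenceBasis_superset hx.coe_range
  obtain ⟨D, hD⟩ := exists_deriv_of_basis ht (Function.extend x w 0 ∘ (↑))
  refine ⟨D, fun i => ?_⟩
  have := hD ⟨x i, hxt ⟨i, rfl⟩⟩
  simpa [hx.injective.extend_apply] using this

end DerivationExistence

section Univariate
open Polynomial

/-- The local lemma at the points at infinity. -/
theorem dvd_of_log_eq (r t h p y : ℂ[X]) (hp : p ≠ 0)
    (H : t * y * p + r * (derivative y * p - y * derivative p) = h * p ^ 2)
    (hr : ∀ z, r.eval z = 0 → ∀ e : ℕ, 0 < e → t.eval z ≠ e * (derivative r).eval z) :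
    p ∣ y := by
  classical
  set g := EuclideanDomain.gcd p y with hg
  have hg0 : g ≠ 0 := fun h0 => hp (EuclideanDomain.gcd_eq_zero_iff.1 h0).1
  obtain ⟨a, ha⟩ : g ∣ p := EuclideanDomain.gcd_dvd_left p y
  obtain ⟨b, hb⟩ : g ∣ y := EuclideanDomain.gcd_dvd_right p y
  have hab : IsCoprime a b := by
    have h1 := EuclideanDomain.gcd_eq_gcd_ab p y
    rw [← hg] at h1
    refine ⟨EuclideanDomain.gcdA p y, EuclideanDomain.gcdB p y, mul_left_cancel₀ hg0 ?_⟩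
    rw [mul_one]
    conv_rhs => rw [h1]
    linear_combination (-EuclideanDomain.gcdA p y) * ha - EuclideanDomain.gcdB p y * hb
  clear_value g
  have ha0 : a ≠ 0 := by rintro rfl; simp at ha; exact hp ha
  have H1 : t * b * a + r * (derivative b * a - b * derivative a) = h * a ^ 2 := by
    apply mul_left_cancel₀ (pow_ne_zero 2 hg0)
    rw [ha, hb] at H
    simp only [derivative_mul] at H
    linear_combination H
  suffices hu : IsUnit a by
    rw [ha, hb]
    exact mul_dvd_mul_left g hu.dvd
  by_contra hu
  obtain ⟨z, hz⟩ := IsAlgClosed.exists_root a (fun h0 => hu (isUnit_iff_degree_eq_zero.2 h0))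
  obtain ⟨a0, ha0eq, hnd⟩ := exists_eq_pow_rootMultiplicity_mul_and_not_dvd a ha0 z
  have hpos : 0 < a.rootMultiplicity z := (rootMultiplicity_pos ha0).2 hz
  obtain ⟨n, hn⟩ := Nat.exists_eq_succ_of_ne_zero hpos.ne'
  rw [hn] at ha0eq
  have ha0z : a0.eval z ≠ 0 := fun h0 => hnd (dvd_iff_isRoot.2 h0)
  have hbz : b.eval z ≠ 0 := by
    intro h0
    obtain ⟨s, t', hst⟩ := hab
    have := congrArg (eval z) hst
    simp [h0, hz.eq_zero] at this
  set l : ℂ[X] := X - C z with hl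
  have hl0 : l ≠ 0 := X_sub_C_ne_zero z
  have hlz : l.eval z = 0 := by simp [hl]
  have hld : derivative l = 1 := by simp [hl]
  have H2 : t * b * l * a0 + r * (derivative b * l * a0
      - b * (((n : ℂ[X]) + 1) * a0 + l * derivative a0)) = h * l ^ (n + 2) * a0 ^ 2 := by
    apply mul_left_cancel₀ (pow_ne_zero n hl0)
    have hda : derivative a = l ^ n * (((n : ℂ[X]) + 1) * a0 + l * derivative a0) := by
      rw [ha0eq, derivative_mul, derivative_pow, hld]
      simp
      ring
    rw [hda, ha0eq] at H1
    simp only [Nat.succ_eq_add_one] at H1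
    linear_combination H1
  have hrz : r.eval z = 0 := by
    have := congrArg (eval z) H2
    simp [hlz] at this
    have hn1 : (n : ℂ) + 1 ≠ 0 := by exact_mod_cast Nat.succ_ne_zero n
    tauto
  obtain ⟨r1, hr1⟩ := dvd_iff_isRoot.2 (show r.IsRoot z from hrz)
  rw [← hl] at hr1
  have hdr : (derivative r).eval z = r1.eval z := by
    rw [hr1, derivative_mul, hld]; simp [hlz]
  have H3 : t * b * a0 + r1 * (derivative b * l * a0
      - b * (((n : ℂ[X]) + 1) * a0 + l * derivative a0)) = h * l ^ (n + 1) * a0 ^ 2 := by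
    apply mul_left_cancel₀ hl0
    rw [hr1] at H2
    linear_combination H2
  have H4 := congrArg (eval z) H3
  simp [hlz] at H4
  apply hr z hrz (n + 1) (Nat.succ_pos n)
  rw [hdr]
  apply mul_right_cancel₀ (mul_ne_zero hbz ha0z)
  push_cast
  linear_combination H4

/-- The final univariate contradiction. -/
theorem univariate_contradiction (d m : ℕ) (hd : 2 ≤ d) (hm : 1 ≤ m)
    (c r k P Q1 Q2 : ℂ[X]) (hP : P.natDegree = m)
    (nonres : ∀ z, r.eval z = 0 → ∀ a b : ℤ, (a ≠ 0 ∨ b ≠ 0) →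
      (a : ℂ) * c.eval z + b * (derivative r).eval z ≠ 0)
    (hQ1 : Q1 = 0 ∨ Q1.natDegree + d ≤ m) (hQ2 : Q2 = 0 ∨ Q2.natDegree + d ≤ m)
    (E0 : (m : ℂ[X]) * c * P + r * derivative P = k * P)
    (E1 : ((m : ℂ[X]) - d) * c * Q1 + r * derivative Q1 + ((m : ℂ[X]) * P - (X : ℂ[X]) * derivative P) = k * Q1)
    (E2 : ((m : ℂ[X]) - d) * c * Q2 + r * derivative Q2 + derivative P = k * Q2) : False := by
  have hP0 : P ≠ 0 := by rintro rfl; simp at hP; omega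
  obtain ⟨s, hs⟩ : P ∣ r * Q2 := by
    refine dvd_of_log_eq r (-(d : ℂ[X]) * c - derivative r) (-(k - m * c)) P (r * Q2) hP0 ?_ ?_
    · simp only [derivative_mul]
      linear_combination (r * P) * E2 - r * Q2 * E0 - P * E0
    · intro z hz e he h
      simp at h
      refine nonres z hz d (e + 1) (Or.inr (by positivity)) ?_
      push_cast
      linear_combination -h
  have h3 : P ∣ Q1 + X * Q2 := by
    refine dvd_of_log_eq r (-(d : ℂ[X]) * c) (s - m) P _ hP0 ?_ ?_
    · simp only [derivative_mul, derivative_add, derivative_X]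
      linear_combination P * E1 + X * P * E2 - (Q1 + X * Q2) * E0 + P * hs
    · intro z hz e he h
      simp at h
      refine nonres z hz d e (Or.inr (by positivity)) ?_
      push_cast
      linear_combination -h
  have h3z : Q1 + X * Q2 = 0 := by
    apply eq_zero_of_dvd_of_natDegree_lt h3
    rw [hP]
    have h1 : Q1.natDegree < m := by
      rcases hQ1 with rfl | h
      · simp; omega
      · omega
    have h2 : (X * Q2).natDegree < m := by
      rcases hQ2 with rfl | h
      · simp; omega
      · have := natDegree_mul_le (p := (X : ℂ[X])) (q := Q2)
        rw [natDegree_X] at this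
        omega
    exact (natDegree_add_le _ _).trans_lt (max_lt h1 h2)
  have hsm : s = m := by
    have : (s - m) * P ^ 2 = 0 := by
      have hd3 := congrArg derivative h3z
      simp only [derivative_mul, derivative_add, derivative_X, derivative_zero] at hd3
      linear_combination -P * E1 - X * P * E2 + (- P * hs) + ((m - d) * c - k) * P * h3z + r * P * hd3
    rcases mul_eq_zero.1 this with h | h
    · exact sub_eq_zero.1 h
    · exact absurd h (pow_ne_zero 2 hP0)
  subst hsm
  have hk : (k - m * c) = m * (d * c + derivative r) := by
    apply mul_right_cancel₀ (pow_ne_zero 2 hP0)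
    have hd3 := congrArg derivative hs
    simp only [derivative_mul, derivative_natCast] at hd3
    linear_combination (r * P) * E2 - r * Q2 * E0 - P * E0 + ((derivative r + d * c) * P + r * derivative P) * hs - r * P * hd3
  have : P ∣ 1 := by
    refine dvd_of_log_eq r (m * (d * c + derivative r)) 0 P 1 hP0 ?_ ?_
    · simp only [derivative_one]
      linear_combination - P * hk - E0
    · intro z hz e he h
      simp at h
      refine nonres z hz (m * d) (m - e) (Or.inl (by positivity)) ?_
      push_cast
      linear_combination h
  have := natDegree_le_of_dvd this one_ne_zero
  simp at this
  omega

/-- Leading coefficient comparison. -/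
theorem natDegree_top (d m : ℕ) (hd : 1 ≤ d) (c r k P : ℂ[X]) (hP0 : P ≠ 0)
    (hc : c.natDegree ≤ d) (hr : r.natDegree ≤ d + 1) (hk : k.natDegree ≤ d - 1)
    (hcr : r.coeff (d + 1) = - c.coeff d) (hc0 : c.coeff d ≠ 0)
    (E0 : (m : ℂ[X]) * c * P + r * derivative P = k * P) : P.natDegree = m := by
  set e := P.natDegree with he
  have h := congrArg (fun q => coeff q (d + e)) E0
  have h1 : (k * P).coeff (d + e) = 0 := by
    apply coeff_eq_zero_of_natDegree_lt
    have := natDegree_mul_le (p := k) (q := P)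
    omega
  have h2 : ((m : ℂ[X]) * c * P).coeff (d + e) = m * c.coeff d * P.coeff e := by
    rw [mul_assoc, ← C_eq_natCast, coeff_C_mul, coeff_mul_add_eq_of_natDegree_le hc le_rfl]
    ring
  have h3 : (r * derivative P).coeff (d + e) = - c.coeff d * (e * P.coeff e) := by
    rcases Nat.eq_zero_or_pos e with h0 | h0
    · have : derivative P = 0 := derivative_of_natDegree_zero (by omega)
      simp [this, h0]
    · obtain ⟨e', he'⟩ : ∃ e', e = e' + 1 := ⟨e - 1, by omega⟩
      have hd' : (derivative P).natDegree ≤ e' := by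
        have := natDegree_derivative_le P
        omega
      rw [he', show d + (e' + 1) = (d + 1) + e' by ring, coeff_mul_add_eq_of_natDegree_le hr hd', hcr,
        coeff_derivative]
      push_cast
      ring
  simp only [coeff_add] at h
  rw [h1, h2, h3] at h
  have hlead : P.coeff e ≠ 0 := by simpa [he] using hP0
  have : ((m : ℂ) - e) = 0 := by
    apply mul_right_cancel₀ (mul_ne_zero hc0 hlead)
    linear_combination h
  have := sub_eq_zero.1 this
  exact_mod_cast this.symm

end Univariate

section Bivariate
open Polynomial

/-- Apply a derivation to all coefficients. -/
noncomputable def coeffDer {A : Type} [CommRing A] [Algebra ℚ A] (D : Derivation ℚ A A) :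
    Derivation ℚ A[X] A[X] :=
  (PolynomialModule.equivPolynomialSelf (R := A)).compDer D.mapCoeffs

theorem coeff_coeffDer {A : Type} [CommRing A] [Algebra ℚ A] (D : Derivation ℚ A A)
    (p : A[X]) (n : ℕ) : (coeffDer D p).coeff n = D (p.coeff n) := rfl

/-- The derivation `∂/∂u` on `ℂ[u][T]`. -/
noncomputable def dU : Derivation ℚ ℂ[X][X] ℂ[X][X] :=
  coeffDer ((derivative' (R := ℂ)).restrictScalars ℚ)

theorem coeff_dU (p : ℂ[X][X]) (n : ℕ) : (dU p).coeff n = derivative (p.coeff n) := rfl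

theorem coeffDer_natDegree_le {A : Type} [CommRing A] [Algebra ℚ A] (D : Derivation ℚ A A)
    (p : A[X]) : (coeffDer D p).natDegree ≤ p.natDegree := by
  rw [natDegree_le_iff_coeff_eq_zero]
  intro n hn
  rw [coeff_coeffDer, coeff_eq_zero_of_natDegree_lt hn, map_zero]

theorem coeffDer_derivative {A : Type} [CommRing A] [Algebra ℚ A] (D : Derivation ℚ A A)
    (p : A[X]) : coeffDer D (derivative p) = derivative (coeffDer D p) := by
  ext n
  simp only [coeff_coeffDer, coeff_derivative]
  rw [D.leibniz]
  have : D ((n : A) + 1) = 0 := by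
    have := D.map_natCast (n + 1)
    push_cast at this
    simpa using this
  rw [this]
  simp [mul_comm]

theorem coeffDer_X {A : Type} [CommRing A] [Algebra ℚ A] (D : Derivation ℚ A A) :
    coeffDer D (X : A[X]) = 0 := by
  ext n
  rw [coeff_coeffDer, coeff_X]
  split_ifs <;> simp

theorem coeffDer_C {A : Type} [CommRing A] [Algebra ℚ A] (D : Derivation ℚ A A) (a : A) :
    coeffDer D (C a) = C (D a) := by
  ext n
  rw [coeff_coeffDer, coeff_C, coeff_C]
  split_ifs <;> simp

theorem eval_coeffDer {A : Type} [CommRing A] [Algebra ℚ A] (D : Derivation ℚ A A) (p : A[X])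
    (z : A) : D (p.eval z) = (coeffDer D p).eval z + (derivative p).eval z * D z := by
  induction p using Polynomial.induction_on' with
  | add p q hp hq => simp only [map_add, eval_add, hp, hq]; ring
  | monomial n a =>
    rw [← C_mul_X_pow_eq_monomial]
    simp [coeffDer_C, coeffDer_X, derivative_X_pow]
    ring

theorem coeffDer_dU (D : Derivation ℚ ℂ ℂ) (p : ℂ[X][X]) :
    coeffDer (coeffDer D) (dU p) = dU (coeffDer (coeffDer D) p) := by
  ext1 n
  rw [coeff_coeffDer, coeff_dU, coeff_dU, coeff_coeffDer, coeffDer_derivative]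

theorem dU_natDegree_le (p : ℂ[X][X]) : (dU p).natDegree ≤ p.natDegree :=
  coeffDer_natDegree_le _ p

theorem natDegree_X_mul_derivative_le (p : ℂ[X][X]) :
    (X * derivative p).natDegree ≤ p.natDegree := by
  rw [natDegree_le_iff_coeff_eq_zero]
  intro n hn
  cases n with
  | zero => simp
  | succ n => rw [coeff_X_mul, coeff_derivative, coeff_eq_zero_of_natDegree_lt hn, zero_mul]

theorem coeff_X_mul_derivative (p : ℂ[X][X]) (n : ℕ) :
    (X * derivative p).coeff n = n * p.coeff n := by
  cases n with
  | zero => simp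
  | succ n => rw [coeff_X_mul, coeff_derivative]; push_cast; ring

/-- Extraction of the homogeneous component at level `m + d - s`. -/
theorem level_eq (d m s : ℕ) (hs : s ≤ d) (F G p k q h : ℂ[X][X]) (α β : ℂ[X])
    (hF : F.natDegree ≤ d) (hG : G.natDegree ≤ d) (hp : p.natDegree ≤ m) (hk : k.natDegree ≤ d)
    (hq : ∀ b, m < b + s → q.coeff b = 0) (hh : ∀ a, d < a + s → h.coeff a = 0)
    (E : F * (X * derivative q) + G * dU q + (C α * (X * derivative p) + C β * dU p)
      = h * p + k * q) :
    ∃ Q : ℂ[X], (s ≤ m → Q = q.coeff (m - s)) ∧ (m < s → Q = 0) ∧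
      ((m : ℂ[X]) - s) * F.coeff d * Q + G.coeff d * derivative Q +
        (if s = d then α * (m * p.coeff m) + β * derivative (p.coeff m) else 0) =
      h.coeff (d - s) * p.coeff m + k.coeff d * Q := by
  have hh' : h.natDegree ≤ d - s := by
    rw [natDegree_le_iff_coeff_eq_zero]
    intro n hn
    exact hh n (by omega)
  have hE := congrArg (fun x => Polynomial.coeff x ((d - s) + m)) E
  simp only [coeff_add] at hE
  rw [coeff_mul_add_eq_of_natDegree_le hh' hp] at hE
  have hex : (C α * (X * derivative p)).coeff (d - s + m) + (C β * dU p).coeff (d - s + m) =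
      (if s = d then α * (m * p.coeff m) + β * derivative (p.coeff m) else 0) := by
    rw [coeff_C_mul, coeff_C_mul, coeff_X_mul_derivative, coeff_dU]
    split_ifs with h1
    · subst h1; simp
    · rw [coeff_eq_zero_of_natDegree_lt (show p.natDegree < d - s + m by omega)]
      simp
  rw [hex] at hE
  by_cases hsm : s ≤ m
  · have hq' : q.natDegree ≤ m - s := by
      rw [natDegree_le_iff_coeff_eq_zero]
      intro n hn
      exact hq n (by omega)
    refine ⟨q.coeff (m - s), fun _ => rfl, fun h => absurd h (by omega), ?_⟩
    rw [show d - s + m = d + (m - s) by omega,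
      coeff_mul_add_eq_of_natDegree_le hF ((natDegree_X_mul_derivative_le q).trans hq'),
      coeff_mul_add_eq_of_natDegree_le hG ((dU_natDegree_le q).trans hq'),
      coeff_mul_add_eq_of_natDegree_le hk hq', coeff_X_mul_derivative, coeff_dU] at hE
    rw [← hE, Nat.cast_sub hsm]
    ring
  · have hq' : q = 0 := by
      ext1 n
      rw [hq n (by omega), coeff_zero]
    refine ⟨0, fun h => absurd h hsm, fun _ => rfl, ?_⟩
    rw [hq'] at hE
    simp at hE
    simp [hE]

/-- The consequence of applying a derivation of `ℂ`. -/
theorem derivation_level (d m : ℕ) (hd : 1 ≤ d) (F G p k : ℂ[X][X]) (α β : ℂ[X])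
    (hF : F.natDegree ≤ d) (hG : G.natDegree ≤ d) (hp : p.natDegree = m) (hk : k.natDegree ≤ d)
    (hk0 : k.coeff 0 = 0)
    (hpdeg : ∀ n, (p.coeff n).natDegree ≤ n)
    (hpm : (p.coeff m).natDegree = m) (hpm0 : p.coeff m ≠ 0)
    (nonres : ∀ z, (G.coeff d).eval z = 0 → ∀ a b : ℤ, (a ≠ 0 ∨ b ≠ 0) →
      (a : ℂ) * (F.coeff d).eval z + b * (derivative (G.coeff d)).eval z ≠ 0)
    (heq : F * (X * derivative p) + G * dU p = k * p)
    (E0 : (m : ℂ[X]) * F.coeff d * p.coeff m + G.coeff d * derivative (p.coeff m)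
      = k.coeff d * p.coeff m)
    (D : Derivation ℚ ℂ ℂ) (hDF : coeffDer (coeffDer D) F = C α)
    (hDG : coeffDer (coeffDer D) G = C β) :
    ∃ Q : ℂ[X], (Q = 0 ∨ Q.natDegree + d ≤ m) ∧
      ((m : ℂ[X]) - d) * F.coeff d * Q + G.coeff d * derivative Q +
        (α * (m * p.coeff m) + β * derivative (p.coeff m)) = k.coeff d * Q := by
  set q0 := coeffDer (coeffDer D) p with hq0
  set h := coeffDer (coeffDer D) k with hh
  have Eq0 : F * (X * derivative q0) + G * dU q0 + (C α * (X * derivative p) + C β * dU p)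
      = h * p + k * q0 := by
    have := congrArg (coeffDer (coeffDer D)) heq
    simp only [map_add, Derivation.leibniz, smul_eq_mul, hDF, hDG, coeffDer_X, coeffDer_derivative,
      coeffDer_dU, ← hq0, ← hh] at this
    linear_combination this
  have hq0deg : ∀ n, (q0.coeff n).natDegree ≤ n := fun n => by
    rw [hq0, coeff_coeffDer]
    exact (coeffDer_natDegree_le _ _).trans (hpdeg n)
  have hq0n : ∀ b, m < b → q0.coeff b = 0 := fun b hb => by
    rw [hq0, coeff_coeffDer, coeff_eq_zero_of_natDegree_lt (by omega), map_zero]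
  have hhn : ∀ a, d < a → h.coeff a = 0 := fun b hb => by
    rw [hh, coeff_coeffDer, coeff_eq_zero_of_natDegree_lt (by omega), map_zero]
  have hh0 : h.coeff 0 = 0 := by rw [hh, coeff_coeffDer, hk0, map_zero]
  clear_value q0 h
  -- the general divisibility step
  have step : ∀ (s : ℕ) (Q H : ℂ[X]), ((m : ℂ[X]) - s) * F.coeff d * Q
      + G.coeff d * derivative Q = H * p.coeff m + k.coeff d * Q → p.coeff m ∣ Q := by
    intro s Q H hQ
    refine dvd_of_log_eq (G.coeff d) (-(s : ℂ[X]) * F.coeff d) H (p.coeff m) Q hpm0 ?_ ?_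
    · linear_combination p.coeff m * hQ - Q * E0
    · intro z hz e he h
      simp at h
      refine nonres z hz s e (Or.inr (by positivity)) ?_
      push_cast
      linear_combination -h
  -- level zero
  obtain ⟨l, hl⟩ : ∃ l : ℂ, q0.coeff m = C l * p.coeff m := by
    obtain ⟨Q, hQ1, -, hQ⟩ := level_eq d m 0 (Nat.zero_le d) F G p k q0 h α β hF hG hp.le hk
      (by simpa using hq0n) (by simpa using hhn) Eq0
    rw [if_neg (by omega), add_zero] at hQ
    obtain ⟨l, hl⟩ := step 0 Q _ hQ
    rw [hQ1 (Nat.zero_le m), Nat.sub_zero] at hl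
    by_cases hl0 : l = 0
    · exact ⟨0, by rw [hl, hl0]; simp⟩
    · have h1 := hq0deg m
      rw [hl, natDegree_mul hpm0 hl0, hpm] at h1
      have h2 := eq_C_of_natDegree_eq_zero (show l.natDegree = 0 by omega)
      exact ⟨l.coeff 0, by rw [hl, ← h2, mul_comm]⟩
  set q := q0 - C (C l) * p with hqdef
  have Eq : F * (X * derivative q) + G * dU q + (C α * (X * derivative p) + C β * dU p)
      = h * p + k * q := by
    have h1 : dU q = dU q0 - C (C l) * dU p := by
      ext1 n
      rw [coeff_dU, coeff_sub, coeff_C_mul, coeff_sub, coeff_C_mul, coeff_dU, coeff_dU]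
      simp
    have h2 : derivative q = derivative q0 - C (C l) * derivative p := by
      simp [hqdef]
    rw [h1, h2, hqdef]
    linear_combination Eq0 - C (C l) * heq
  have hqdeg : ∀ n, (q.coeff n).natDegree ≤ n := fun n => by
    rw [hqdef, coeff_sub, coeff_C_mul]
    refine (natDegree_sub_le _ _).trans (max_le (hq0deg n) ?_)
    exact (natDegree_C_mul_le _ _).trans (hpdeg n)
  have hqn : ∀ b, m < b + 1 → q.coeff b = 0 := fun b hb => by
    rw [hqdef, coeff_sub, coeff_C_mul]
    rcases Nat.lt_or_ge m b with h1 | h1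
    · rw [hq0n b h1, coeff_eq_zero_of_natDegree_lt (by omega)]; simp
    · obtain rfl : b = m := by omega
      rw [hl, sub_self]
  have hhd : h.coeff d = 0 := by
    obtain ⟨Q, hQ1, -, hQ⟩ := level_eq d m 0 (Nat.zero_le d) F G p k q h α β hF hG hp.le hk
      (fun b hb => hqn b (by omega)) (by simpa using hhn) Eq
    rw [hQ1 (Nat.zero_le m), Nat.sub_zero, hqn m (by omega), if_neg (by omega)] at hQ
    simp at hQ
    rcases hQ with h | h
    · exact h
    · exact absurd h hpm0
  have claim : ∀ s, s + 1 ≤ d → (∀ b, m < b + (s + 1) → q.coeff b = 0) ∧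
      (∀ a, d < a + (s + 1) → h.coeff a = 0) := by
    intro s
    induction s with
    | zero =>
      intro _
      refine ⟨hqn, fun a ha => ?_⟩
      rcases Nat.lt_or_ge d a with h1 | h1
      · exact hhn a h1
      · obtain rfl : a = d := by omega
        exact hhd
    | succ s ih =>
      intro hs
      obtain ⟨ih1, ih2⟩ := ih (by omega)
      obtain ⟨Q, hQ1, hQ2, hQ⟩ := level_eq d m (s + 1) (by omega) F G p k q h α β hF hG hp.le hk
        ih1 ih2 Eq
      rw [if_neg (by omega), add_zero] at hQ
      have hdv := step (s + 1) Q _ hQ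
      have hQz : Q = 0 := by
        by_cases hsm : s + 1 ≤ m
        · apply eq_zero_of_dvd_of_natDegree_lt hdv
          rw [hpm, hQ1 hsm]
          have := hqdeg (m - (s + 1))
          omega
        · exact hQ2 (by omega)
      rw [hQz] at hQ
      simp at hQ
      have hhz : h.coeff (d - (s + 1)) = 0 := by
        rcases hQ with h | h
        · exact h
        · exact absurd h hpm0
      constructor
      · intro b hb
        by_cases h1 : m < b + (s + 1)
        · exact ih1 b h1
        · have := hQ1 (by omega)
          rw [hQz] at this
          rw [this]
          congr 1
          omega
      · intro a ha
        by_cases h1 : d < a + (s + 1)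
        · exact ih2 a h1
        · rw [← hhz]
          congr 1
          omega
  obtain ⟨c1, c2⟩ := claim (d - 1) (by omega)
  rw [show d - 1 + 1 = d by omega] at c1 c2
  obtain ⟨Q, hQ1, hQ2, hQ⟩ := level_eq d m d le_rfl F G p k q h α β hF hG hp.le hk c1 c2 Eq
  refine ⟨Q, ?_, ?_⟩
  · by_cases hdm : d ≤ m
    · right
      rw [hQ1 hdm]
      have := hqdeg (m - d)
      omega
    · exact Or.inl (hQ2 (by omega))
  · rw [if_pos rfl, Nat.sub_self, hh0, zero_mul, zero_add] at hQ
    exact hQ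

/-- The core contradiction in blown-up coordinates. -/
theorem core (d m : ℕ) (hd : 2 ≤ d) (hm : 1 ≤ m) (F G p K : ℂ[X][X])
    (hF : F.natDegree ≤ d) (hG : G.natDegree ≤ d) (hp : p.natDegree = m)
    (hpdeg : ∀ n, (p.coeff n).natDegree ≤ n) (hKdeg : ∀ n, (K.coeff n).natDegree ≤ n)
    (heq : F * (X * derivative p) + G * dU p = (X * K) * p)
    (hc : (F.coeff d).natDegree ≤ d) (hr : (G.coeff d).natDegree ≤ d + 1)
    (hcr : (G.coeff d).coeff (d + 1) = - (F.coeff d).coeff d) (hc0 : (F.coeff d).coeff d ≠ 0)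
    (nonres : ∀ z, (G.coeff d).eval z = 0 → ∀ a b : ℤ, (a ≠ 0 ∨ b ≠ 0) →
      (a : ℂ) * (F.coeff d).eval z + b * (derivative (G.coeff d)).eval z ≠ 0)
    (D1 D2 : Derivation ℚ ℂ ℂ)
    (hDF1 : coeffDer (coeffDer D1) F = C 1) (hDG1 : coeffDer (coeffDer D1) G = C (-X))
    (hDF2 : coeffDer (coeffDer D2) F = C 0) (hDG2 : coeffDer (coeffDer D2) G = C 1) : False := by
  have hp0 : p ≠ 0 := by rintro rfl; simp at hp; omega
  have hpm0 : p.coeff m ≠ 0 := by rw [← hp]; simpa using hp0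
  have hk : (X * K).natDegree ≤ d := by
    by_cases hk0 : X * K = 0
    · rw [hk0]; simp
    have h1 := natDegree_mul hk0 hp0
    rw [← heq, hp] at h1
    have h2 : (F * (X * derivative p) + G * dU p).natDegree ≤ d + m := by
      refine (natDegree_add_le _ _).trans (max_le ?_ ?_)
      · exact natDegree_mul_le.trans
          (add_le_add hF ((natDegree_X_mul_derivative_le p).trans hp.le))
      · exact natDegree_mul_le.trans (add_le_add hG ((dU_natDegree_le p).trans hp.le))
    omega
  have hkd : ((X * K).coeff d).natDegree ≤ d - 1 := by
    rw [show d = (d - 1) + 1 by omega, coeff_X_mul]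
    simpa using hKdeg (d - 1)
  have E0 : (m : ℂ[X]) * F.coeff d * p.coeff m + G.coeff d * derivative (p.coeff m)
      = (X * K).coeff d * p.coeff m := by
    have := congrArg (fun x => Polynomial.coeff x (d + m)) heq
    simp only [coeff_add] at this
    rw [coeff_mul_add_eq_of_natDegree_le hF ((natDegree_X_mul_derivative_le p).trans hp.le),
      coeff_mul_add_eq_of_natDegree_le hG ((dU_natDegree_le p).trans hp.le),
      coeff_mul_add_eq_of_natDegree_le hk hp.le, coeff_X_mul_derivative, coeff_dU] at this
    rw [← this]
    ring
  have hpm := natDegree_top d m (by omega) _ _ _ _ hpm0 hc hr hkd hcr hc0 E0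
  obtain ⟨Q1, hQ1, e1⟩ := derivation_level d m (by omega) F G p (X * K) 1 (-X) hF hG hp hk (by simp)
    hpdeg hpm hpm0 nonres heq E0 D1 hDF1 hDG1
  obtain ⟨Q2, hQ2, e2⟩ := derivation_level d m (by omega) F G p (X * K) 0 1 hF hG hp hk (by simp)
    hpdeg hpm hpm0 nonres heq E0 D2 hDF2 hDG2
  refine univariate_contradiction d m hd hm _ _ _ _ Q1 Q2 hpm nonres hQ1 hQ2 E0 ?_ ?_
  · rw [← e1]; ring
  · rw [← e2]; ring

end Bivariate

section Substitution
open Polynomial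

/-- The blow-up substitution `x ↦ T`, `y ↦ u T`. -/
noncomputable def blowup : MvPolynomial (Fin 2) ℂ →ₐ[ℂ] ℂ[X][X] :=
  MvPolynomial.aeval ![X, C X * X]

theorem blowup_X0 : blowup (MvPolynomial.X 0) = X := by simp [blowup]

theorem blowup_X1 : blowup (MvPolynomial.X 1) = C X * X := by simp [blowup]

theorem blowup_C (a : ℂ) : blowup (MvPolynomial.C a) = C (C a) := by
  simp [blowup]

theorem blowup_monomial (s : Fin 2 →₀ ℕ) (a : ℂ) :
    blowup (MvPolynomial.monomial s a) = monomial (s 0 + s 1) (monomial (s 1) a) := by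
  rw [MvPolynomial.monomial_eq, map_mul, blowup_C, Finsupp.prod_fintype _ _ (by simp)]
  simp only [Fin.prod_univ_two, map_mul, map_pow, blowup_X0, blowup_X1]
  rw [← C_mul_X_pow_eq_monomial, ← C_mul_X_pow_eq_monomial]
  simp only [map_mul, map_pow]
  ring

theorem coeff_blowup (P : MvPolynomial (Fin 2) ℂ) (n j : ℕ) :
    ((blowup P).coeff n).coeff j = if j ≤ n then
      P.coeff (Finsupp.single (0 : Fin 2) (n - j) + Finsupp.single (1 : Fin 2) j) else 0 := by
  induction P using MvPolynomial.induction_on' with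
  | add p q hp hq =>
    simp only [map_add, coeff_add, hp, hq, MvPolynomial.coeff_add]
    split_ifs <;> simp
  | monomial s a =>
    rw [blowup_monomial, coeff_monomial, MvPolynomial.coeff_monomial]
    by_cases h : s = Finsupp.single (0 : Fin 2) (n - j) + Finsupp.single (1 : Fin 2) j
    · have h0 : s 0 = n - j := by rw [h]; simp
      have h1 : s 1 = j := by rw [h]; simp
      rw [if_pos h, h0, h1]
      by_cases hj : j ≤ n
      · rw [if_pos (by omega), if_pos hj]; simp
      · rw [if_neg (by omega), if_neg hj]; simp
    · rw [if_neg h, ite_self]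
      by_cases hn : s 0 + s 1 = n
      · rw [if_pos hn, coeff_monomial, if_neg]
        intro hj
        apply h
        ext i
        fin_cases i
        · simp; omega
        · simp; omega
      · rw [if_neg hn]; simp

theorem natDegree_coeff_blowup (P : MvPolynomial (Fin 2) ℂ) (n : ℕ) :
    ((blowup P).coeff n).natDegree ≤ n := by
  rw [natDegree_le_iff_coeff_eq_zero]
  intro j hj
  rw [coeff_blowup, if_neg (by omega)]

theorem natDegree_blowup (P : MvPolynomial (Fin 2) ℂ) : (blowup P).natDegree ≤ P.totalDegree := by
  rw [natDegree_le_iff_coeff_eq_zero]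
  intro n hn
  ext j
  rw [coeff_blowup]
  split_ifs with hj
  · rw [coeff_zero]
    apply MvPolynomial.coeff_eq_zero_of_totalDegree_lt
    rw [← Finsupp.degree_apply, map_add, Finsupp.degree_single, Finsupp.degree_single]
    omega
  · simp

theorem blowup_natDegree_pos (P : MvPolynomial (Fin 2) ℂ) (hP : 0 < P.totalDegree) :
    1 ≤ (blowup P).natDegree := by
  by_contra hlt
  apply hP.ne'
  rw [MvPolynomial.totalDegree_eq_zero_iff]
  intro s hs i
  by_contra hi
  have h1 := coeff_blowup P (s 0 + s 1) (s 1)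
  have hz : (blowup P).coeff (s 0 + s 1) = 0 :=
    coeff_eq_zero_of_natDegree_lt (by fin_cases i <;> simp at hi <;> omega)
  rw [if_pos (by omega), hz, coeff_zero] at h1
  have hs' : s = Finsupp.single (0 : Fin 2) (s 0 + s 1 - s 1) + Finsupp.single (1 : Fin 2) (s 1) := by
    ext i
    fin_cases i <;> simp
  rw [← hs'] at h1
  exact (MvPolynomial.mem_support_iff.1 hs) h1.symm

theorem blowup_pderiv_one (P : MvPolynomial (Fin 2) ℂ) :
    X * blowup (MvPolynomial.pderiv 1 P) = dU (blowup P) := by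
  have hX : dU (X : ℂ[X][X]) = 0 := coeffDer_X _
  have hC : ∀ a : ℂ[X], dU (C a) = C (derivative a) := fun a => coeffDer_C _ a
  induction P using MvPolynomial.induction_on with
  | C a => simp [blowup_C, hC]
  | add p q hp hq => simp only [map_add, mul_add, hp, hq]
  | mul_X p i hp =>
    simp only [Derivation.leibniz, smul_eq_mul, map_mul, map_add]
    rw [← hp]
    fin_cases i
    · simp [blowup_X0, hX, MvPolynomial.pderiv_X]
    · simp [blowup_X1, hX, hC, MvPolynomial.pderiv_X]
      ring

theorem blowup_pderiv_zero (P : MvPolynomial (Fin 2) ℂ) :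
    X * blowup (MvPolynomial.pderiv 0 P) = X * derivative (blowup P) - C X * dU (blowup P) := by
  rw [← blowup_pderiv_one]
  induction P using MvPolynomial.induction_on with
  | C a => simp [blowup_C]
  | add p q hp hq =>
    simp only [map_add, mul_add, hp, hq]
    ring
  | mul_X p i hp =>
    simp only [map_mul, Derivation.leibniz, derivative_mul, map_add, smul_eq_mul]
    fin_cases i
    · simp [blowup_X0, MvPolynomial.pderiv_X]
      linear_combination X * hp
    · simp [blowup_X1, MvPolynomial.pderiv_X]
      linear_combination C X * X * hp

end Substitution

section Genericity
open Polynomial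

theorem exists_deriv_coeffs {d : ℕ} {f g : MvPolynomial (Fin 2) ℂ}
    (hindep : AlgebraicIndependent ℚ
      (fun c : Bool × {ij : ℕ × ℕ // ij.1 + ij.2 ≤ d} =>
        MvPolynomial.coeff
          (Finsupp.single (0 : Fin 2) c.2.1.1 + Finsupp.single (1 : Fin 2) c.2.1.2)
          (if c.1 then f else g)))
    (hf : f.totalDegree ≤ d) (hg : g.totalDegree ≤ d)
    (A B : ℂ[X][X]) (hA : A.natDegree ≤ d) (hB : B.natDegree ≤ d)
    (hA' : ∀ n, (A.coeff n).natDegree ≤ n) (hB' : ∀ n, (B.coeff n).natDegree ≤ n) :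
    ∃ D : Derivation ℚ ℂ ℂ, coeffDer (coeffDer D) (blowup f) = A ∧
      coeffDer (coeffDer D) (blowup g) = B := by
  obtain ⟨D, hD⟩ := exists_deriv hindep (fun c => if c.1 then
    (A.coeff (c.2.1.1 + c.2.1.2)).coeff c.2.1.2 else (B.coeff (c.2.1.1 + c.2.1.2)).coeff c.2.1.2)
  have key : ∀ (b : Bool) (h : MvPolynomial (Fin 2) ℂ) (E : ℂ[X][X]),
      h = (if b then f else g) → E = (if b then A else B) → h.totalDegree ≤ d → E.natDegree ≤ d →
      (∀ n, (E.coeff n).natDegree ≤ n) → coeffDer (coeffDer D) (blowup h) = E := by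
    intro b h E hb hE hh hEd hEd'
    ext n j
    rw [coeff_coeffDer, coeff_coeffDer]
    by_cases hn : n ≤ d
    · rw [coeff_blowup]
      split_ifs with hj
      · have h1 := hD (b, ⟨(n - j, j), by simp; omega⟩)
        dsimp only at h1
        rw [← hb] at h1
        rw [h1, hE]
        cases b <;> simp [Nat.sub_add_cancel hj]
      · rw [map_zero, coeff_eq_zero_of_natDegree_lt]
        exact (hEd' n).trans_lt (by omega)
    · rw [coeff_eq_zero_of_natDegree_lt (p := E) (by omega),
        coeff_eq_zero_of_natDegree_lt ((natDegree_blowup h).trans_lt (by omega))]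
      simp
  exact ⟨D, key true f A rfl rfl hf hA hA', key false g B rfl rfl hg hB hB'⟩

theorem nonresonance {d : ℕ} (hd : 2 ≤ d) {f g : MvPolynomial (Fin 2) ℂ}
    (hindep : AlgebraicIndependent ℚ
      (fun c : Bool × {ij : ℕ × ℕ // ij.1 + ij.2 ≤ d} =>
        MvPolynomial.coeff
          (Finsupp.single (0 : Fin 2) c.2.1.1 + Finsupp.single (1 : Fin 2) c.2.1.2)
          (if c.1 then f else g)))
    (hf : f.totalDegree ≤ d) (hg : g.totalDegree ≤ d) (c r : ℂ[X])
    (hc : c = (blowup f).coeff d) (hr : r = (blowup g).coeff d - X * (blowup f).coeff d)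
    (z : ℂ) (hz : r.eval z = 0) (a b : ℤ) (hab : a ≠ 0 ∨ b ≠ 0) :
    (a : ℂ) * c.eval z + b * (derivative r).eval z ≠ 0 := by
  have hder : ∀ A B : ℂ[X], A.natDegree ≤ d → B.natDegree ≤ d → ∃ D : Derivation ℚ ℂ ℂ,
      coeffDer D c = A ∧ coeffDer D r = B - X * A := by
    intro A B hA hB
    have hmon : ∀ A : ℂ[X], A.natDegree ≤ d → ∀ n, ((monomial d A).coeff n).natDegree ≤ n := by
      intro A hA n
      rw [coeff_monomial]
      split_ifs with h
      · omega
      · simp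
    obtain ⟨D, h1, h2⟩ := exists_deriv_coeffs hindep hf hg (monomial d A) (monomial d B)
      (natDegree_monomial_le _) (natDegree_monomial_le _) (hmon A hA) (hmon B hB)
    have h1' := congrArg (fun x => Polynomial.coeff x d) h1
    have h2' := congrArg (fun x => Polynomial.coeff x d) h2
    simp only [coeff_coeffDer, coeff_monomial_same] at h1' h2'
    refine ⟨D, by rw [hc, h1'], ?_⟩
    rw [hr, map_sub, Derivation.leibniz, coeffDer_X, h1', h2']
    simp
  have hrho : (derivative r).eval z ≠ 0 := by
    intro h0
    obtain ⟨D, -, h2⟩ := hder 0 1 (by simp) (by simp)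
    have := eval_coeffDer D r z
    rw [hz, h2, h0] at this
    simp at this
  intro h
  have ha : a ≠ 0 := by
    rintro rfl
    have hb : b ≠ 0 := by simpa using hab
    simp [hb] at h
    exact hrho h
  obtain ⟨D, h1, h2⟩ := hder 1 X (by simp) (by rw [natDegree_X]; omega)
  have e1 := eval_coeffDer D r z
  rw [hz, h2] at e1
  simp [hrho] at e1
  have e2 := eval_coeffDer D c z
  rw [h1, e1] at e2
  have e3 := eval_coeffDer D (derivative r) z
  rw [coeffDer_derivative, h2, e1] at e3
  have e4 := congrArg D h
  simp only [map_add, Derivation.leibniz, Derivation.map_intCast, e2, e3] at e4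
  simp at e4
  exact ha e4

theorem leading_ne_zero {d : ℕ} {f g : MvPolynomial (Fin 2) ℂ}
    (hindep : AlgebraicIndependent ℚ
      (fun c : Bool × {ij : ℕ × ℕ // ij.1 + ij.2 ≤ d} =>
        MvPolynomial.coeff
          (Finsupp.single (0 : Fin 2) c.2.1.1 + Finsupp.single (1 : Fin 2) c.2.1.2)
          (if c.1 then f else g))) : ((blowup f).coeff d).coeff d ≠ 0 := by
  have := hindep.ne_zero (true, ⟨(0, d), by simp⟩)
  rw [coeff_blowup, if_pos le_rfl]
  simpa using this

end Genericity

open MvPolynomial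

/-- Landis–Petrovskii, no invariant algebraic curve.
Let `d ≥ 2` and let `f, g ∈ ℂ[x,y]` have degree at most `d`, with the
`(d+1)(d+2)` coefficients `f_{ij}, g_{ij}` (`i + j ≤ d`) algebraically
independent over `ℚ`. Then the planar vector field `v = f ∂/∂x + g ∂/∂y`
admits no invariant algebraic curve: there is no nonconstant `P ∈ ℂ[x,y]`
with `f·∂P/∂x + g·∂P/∂y ∈ (P)`. -/
theorem no_invariant_algebraic_curve
    (d : ℕ) (hd : 2 ≤ d)
    (f g : MvPolynomial (Fin 2) ℂ)
    (hf : f.totalDegree ≤ d) (hg : g.totalDegree ≤ d)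
    (hindep : AlgebraicIndependent ℚ
      (fun c : Bool × {ij : ℕ × ℕ // ij.1 + ij.2 ≤ d} =>
        MvPolynomial.coeff
          (Finsupp.single (0 : Fin 2) c.2.1.1 + Finsupp.single (1 : Fin 2) c.2.1.2)
          (if c.1 then f else g))) :
    ¬ ∃ P : MvPolynomial (Fin 2) ℂ, 0 < P.totalDegree ∧
      f * MvPolynomial.pderiv 0 P + g * MvPolynomial.pderiv 1 P ∈ Ideal.span {P} := by
  rintro ⟨P, hP, hmem⟩
  obtain ⟨K, hK⟩ := Ideal.mem_span_singleton'.1 hmem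
  have hCX : ∀ D : Derivation ℚ ℂ ℂ,
      coeffDer (coeffDer D) (Polynomial.C Polynomial.X : Polynomial (Polynomial ℂ)) = 0 := by
    intro D
    rw [coeffDer_C, coeffDer_X, Polynomial.C_0]
  have hcG : (blowup g - Polynomial.C Polynomial.X * blowup f).coeff d =
      (blowup g).coeff d - Polynomial.X * (blowup f).coeff d := by
    rw [Polynomial.coeff_sub, Polynomial.coeff_C_mul]
  obtain ⟨D1, h11, h12⟩ := exists_deriv_coeffs hindep hf hg 1 0 (by simp) (by simp)
    (fun n => by rw [Polynomial.coeff_one]; split_ifs <;> simp) (by simp)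
  obtain ⟨D2, h21, h22⟩ := exists_deriv_coeffs hindep hf hg 0 1 (by simp) (by simp) (by simp)
    (fun n => by rw [Polynomial.coeff_one]; split_ifs <;> simp)
  have hfd := (natDegree_blowup f).trans hf
  have hgd := (natDegree_blowup g).trans hg
  refine core d _ hd (blowup_natDegree_pos P hP) (blowup f)
    (blowup g - Polynomial.C Polynomial.X * blowup f) (blowup P) (blowup K) hfd ?_ rfl
    (natDegree_coeff_blowup P) (natDegree_coeff_blowup K) ?_ (natDegree_coeff_blowup f d) ?_ ?_
    (leading_ne_zero hindep) ?_ D1 D2 ?_ ?_ ?_ ?_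
  · exact (Polynomial.natDegree_sub_le _ _).trans
      (max_le hgd ((Polynomial.natDegree_C_mul_le _ _).trans hfd))
  · have h := congrArg (fun x => Polynomial.X * blowup x) hK
    simp only [map_mul, map_add] at h
    have e0 := blowup_pderiv_zero P
    have e1 := blowup_pderiv_one P
    linear_combination -h - blowup f * e0 - blowup g * e1
  · rw [hcG]
    refine (Polynomial.natDegree_sub_le _ _).trans
      (max_le ((natDegree_coeff_blowup g d).trans (by omega)) ?_)
    refine Polynomial.natDegree_mul_le.trans ?_
    rw [Polynomial.natDegree_X]
    have := natDegree_coeff_blowup f d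
    omega
  · rw [hcG, Polynomial.coeff_sub, Polynomial.coeff_X_mul, Polynomial.coeff_eq_zero_of_natDegree_lt
      (Nat.lt_succ_of_le (natDegree_coeff_blowup g d)), zero_sub]
  · intro z hz a b hab
    exact nonresonance hd hindep hf hg _ _ rfl hcG z hz a b hab
  · rw [h11, Polynomial.C_1]
  · rw [map_sub, Derivation.leibniz, hCX, h11, h12]
    simp
  · rw [h21, Polynomial.C_0]
  · rw [map_sub, Derivation.leibniz, hCX, h21, h22]
    simp
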